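/- For all m, m_1, m_2 ∈ ℤ and both choices of sign ±, the operators on the Fock module V satisfy the Serre relation [x_{n−1}^±(m_2), [x_{n−1}^±(m_1), x_n^±(m)]] = 0, where both brackets are ordinary commutators of operators (x_{n−1}^± is even). -/

import Mathlib

noncomputable section

open scoped BigOperators

/-- Bosonic labels: `none` is β, `some i` is ε_{i+1} (so ε_1, …, ε_n). -/
abbrev BL (n : ℕ) := Option (Fin n)

/-- The symmetric pairing on bosonic labels: (β|β)=1, (β|ε_i)=δ_{i1}, (ε_i|ε_j)=δ_{ij}. -/
def pairB (n : ℕ) : BL n → BL n → ℂ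
  | none, none => 1
  | none, some i => if (i : ℕ) = 0 then 1 else 0
  | some i, none => if (i : ℕ) = 0 then 1 else 0
  | some i, some j => if i = j then 1 else 0

/-- Generators of Λ: unstarred bosons u(k), starred bosons u*(k), and the ghost e(k). -/
inductive TGen (n : ℕ) : Type
  | un : BL n → ℤ → TGen n
  | st : BL n → ℤ → TGen n
  | e : ℤ → TGen n

open FreeAlgebra in
/-- Defining relations of Λ. -/
inductive TRel (n : ℕ) : FreeAlgebra ℂ (TGen n) → FreeAlgebra ℂ (TGen n) → Prop
  | unun (u v : BL n) (k l : ℤ) :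
      TRel n (ι ℂ (TGen.un u k) * ι ℂ (TGen.un v l)) (ι ℂ (TGen.un v l) * ι ℂ (TGen.un u k))
  | stst (u v : BL n) (k l : ℤ) :
      TRel n (ι ℂ (TGen.st u k) * ι ℂ (TGen.st v l)) (ι ℂ (TGen.st v l) * ι ℂ (TGen.st u k))
  | unst (u v : BL n) (k l : ℤ) :
      TRel n (ι ℂ (TGen.un u k) * ι ℂ (TGen.st v l))
        (ι ℂ (TGen.st v l) * ι ℂ (TGen.un u k) +
          algebraMap ℂ _ (if k + l = 0 then pairB n u v else 0))
  | une (u : BL n) (k l : ℤ) :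
      TRel n (ι ℂ (TGen.un u k) * ι ℂ (TGen.e l)) (ι ℂ (TGen.e l) * ι ℂ (TGen.un u k))
  | ste (u : BL n) (k l : ℤ) :
      TRel n (ι ℂ (TGen.st u k) * ι ℂ (TGen.e l)) (ι ℂ (TGen.e l) * ι ℂ (TGen.st u k))
  | ee (k l : ℤ) :
      TRel n (ι ℂ (TGen.e k) * ι ℂ (TGen.e l) + ι ℂ (TGen.e l) * ι ℂ (TGen.e k))
        (algebraMap ℂ _ (if k + l = 0 then (1 : ℂ) else 0))

/-- The algebra Λ. -/
abbrev Lam (n : ℕ) := RingQuot (TRel n)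

/-- Image of a generator in Λ. -/
def gen (n : ℕ) (x : TGen n) : Lam n :=
  RingQuot.mkAlgHom ℂ (TRel n) (FreeAlgebra.ι ℂ x)

/-- The mode index of a generator. -/
def TGen.idx {n : ℕ} : TGen n → ℤ
  | .un _ k => k
  | .st _ k => k
  | .e k => k

/-- The left ideal generated by all generators of index ≥ 1. -/
def fockIdeal (n : ℕ) : Submodule (Lam n) (Lam n) :=
  Submodule.span (Lam n) {a | ∃ x : TGen n, 1 ≤ x.idx ∧ a = gen n x}

/-- The Fock module V = Λ/I. -/
abbrev Fock (n : ℕ) := Lam n ⧸ fockIdeal n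

/-- Series of unstarred bosonic generators. -/
def unS (n : ℕ) (u : BL n) : ℤ → Lam n := fun k => gen n (.un u k)
/-- Series of starred bosonic generators. -/
def stS (n : ℕ) (u : BL n) : ℤ → Lam n := fun k => gen n (.st u k)
/-- Series of ghost generators. -/
def eS (n : ℕ) : ℤ → Lam n := fun k => gen n (.e k)

/-- ε_i(·) for 1 ≤ i ≤ n (1-based index; junk value 0 outside the range). -/
def epU (n : ℕ) (i : ℕ) : ℤ → Lam n :=
  if h : 1 ≤ i ∧ i ≤ n then unS n (some ⟨i - 1, by omega⟩) else 0
/-- ε_i*(·) for 1 ≤ i ≤ n. -/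
def epSt (n : ℕ) (i : ℕ) : ℤ → Lam n :=
  if h : 1 ≤ i ∧ i ≤ n then stS n (some ⟨i - 1, by omega⟩) else 0

/-- Normal ordering of a bosonic pair :x(k)y(l): as an element of Λ. -/
def nob (n : ℕ) (x y : ℤ → Lam n) (k l : ℤ) : Lam n :=
  if k < 0 then x k * y l
  else if 0 < k then y l * x k
  else (2⁻¹ : ℂ) • (x 0 * y l + y l * x 0)

/-- The operator on V given by the locally finite sum Σ_{k∈ℤ} f(k)·(·). -/
def sumOp (n : ℕ) (f : ℤ → Lam n) : Fock n → Fock n := fun v => ∑ᶠ k : ℤ, f k • v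

/-- α_i(m), 0 ≤ i ≤ n. -/
def αop (n : ℕ) (i : ℕ) (m : ℤ) : Fock n → Fock n :=
  if i = 0 then sumOp n (fun k => (-2 : ℂ) • nob n (stS n none) (unS n none) k (m - k))
  else if i = n then sumOp n (fun k => nob n (epU n n) (epSt n n) k (m - k))
  else sumOp n (fun k =>
    nob n (epU n i) (epSt n i) k (m - k) - nob n (epU n (i + 1)) (epSt n (i + 1)) k (m - k))

/-- x_i^+(m), 0 ≤ i ≤ n. -/
def xp (n : ℕ) (i : ℕ) (m : ℤ) : Fock n → Fock n :=
  if i = 0 then sumOp n (fun k => (2⁻¹ : ℂ) • nob n (stS n none) (stS n none) k (m - k))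
  else if i = n then sumOp n (fun k => ((Real.sqrt 2 : ℝ) : ℂ) • (epU n n k * eS n (m - k)))
  else sumOp n (fun k => nob n (epU n i) (epSt n (i + 1)) k (m - k))

/-- x_i^−(m), 0 ≤ i ≤ n. -/
def xm (n : ℕ) (i : ℕ) (m : ℤ) : Fock n → Fock n :=
  if i = 0 then sumOp n (fun k => (2⁻¹ : ℂ) • nob n (unS n none) (unS n none) k (m - k))
  else if i = n then sumOp n (fun k => (-((Real.sqrt 2 : ℝ) : ℂ)) • (epSt n n k * eS n (m - k)))
  else sumOp n (fun k => -(nob n (epU n (i + 1)) (epSt n i) k (m - k)))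

/-- The vector ε_i (1 ≤ i ≤ n) as a coefficient function on bosonic labels. -/
def epsVec (n : ℕ) (i : ℕ) : BL n → ℂ
  | none => 0
  | some j => if (j : ℕ) + 1 = i then 1 else 0

/-- The vector β as a coefficient function. -/
def betaVec (n : ℕ) : BL n → ℂ
  | none => 1
  | some _ => 0

/-- Bilinear extension of the pairing to ℂ-linear combinations of β, ε_1, …, ε_n. -/
def formC (n : ℕ) (f g : BL n → ℂ) : ℂ := ∑ u : BL n, ∑ v : BL n, f u * g v * pairB n u v

/-- The root vectors: α_0 = −2β, α_i = ε_i − ε_{i+1} (1 ≤ i ≤ n−1), α_n = ε_n. -/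
def αvec (n : ℕ) (i : ℕ) : BL n → ℂ :=
  if i = 0 then fun u => -2 * betaVec n u
  else if i = n then epsVec n n
  else fun u => epsVec n i u - epsVec n (i + 1) u

/-- Commutator of operators on the Fock module. -/
def obrk (n : ℕ) (f g : Fock n → Fock n) : Fock n → Fock n := fun v => f (g v) - g (f v)

section FockModule

variable {n : ℕ}

/-! ### Relations between the generators of Λ -/

theorem unS_commute_unS (u v : BL n) (k l : ℤ) : Commute (unS n u k) (unS n v l) := by
  simpa only [map_mul] using! RingQuot.mkAlgHom_rel ℂ (TRel.unun u v k l)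

theorem stS_commute_stS (u v : BL n) (k l : ℤ) : Commute (stS n u k) (stS n v l) := by
  simpa only [map_mul] using! RingQuot.mkAlgHom_rel ℂ (TRel.stst u v k l)

theorem unS_commute_eS (u : BL n) (k l : ℤ) : Commute (unS n u k) (eS n l) := by
  simpa only [map_mul] using! RingQuot.mkAlgHom_rel ℂ (TRel.une u k l)

theorem stS_commute_eS (u : BL n) (k l : ℤ) : Commute (stS n u k) (eS n l) := by
  simpa only [map_mul] using! RingQuot.mkAlgHom_rel ℂ (TRel.ste u k l)

theorem unS_mul_stS (u v : BL n) (k l : ℤ) :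
    unS n u k * stS n v l =
      stS n v l * unS n u k + algebraMap ℂ _ (if k + l = 0 then pairB n u v else 0) := by
  simpa only [map_mul, map_add, AlgHom.commutes] using!
    RingQuot.mkAlgHom_rel ℂ (TRel.unst u v k l)

theorem eS_mul_eS (k l : ℤ) :
    eS n k * eS n l + eS n l * eS n k = algebraMap ℂ _ (if k + l = 0 then (1 : ℂ) else 0) := by
  simpa only [map_mul, map_add, AlgHom.commutes] using!
    RingQuot.mkAlgHom_rel ℂ (TRel.ee (n := n) k l)

theorem unS_commute_stS_of_ne {i j : Fin n} (hij : i ≠ j) (k l : ℤ) :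
    Commute (unS n (some i) k) (stS n (some j) l) := by
  have h := unS_mul_stS (some i) (some j) k l
  simpa [pairB, hij] using! h

/-- Two generators whose modes do not sum to zero commute or anticommute. -/
theorem gen_mul_gen_of_idx_add_ne_zero (x y : TGen n) (h : x.idx + y.idx ≠ 0) :
    gen n x * gen n y = gen n y * gen n x ∨ gen n x * gen n y = -(gen n y * gen n x) := by
  cases x with
  | un u k =>
    cases y with
    | un v l => exact .inl (unS_commute_unS u v k l)
    | st v l =>
      left
      have h' : k + l ≠ 0 := h
      simpa [h'] using! unS_mul_stS u v k l
    | e l => exact .inl (unS_commute_eS u k l)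
  | st u k =>
    cases y with
    | un v l =>
      left
      have h' : l + k ≠ 0 := by rw [add_comm]; exact h
      simpa [h'] using! (unS_mul_stS v u l k).symm
    | st v l => exact .inl (stS_commute_stS u v k l)
    | e l => exact .inl (stS_commute_eS u k l)
  | e k =>
    cases y with
    | un v l => exact .inl (unS_commute_eS v l k).symm
    | st v l => exact .inl (stS_commute_eS v l k).symm
    | e l =>
      right
      have h' : k + l ≠ 0 := h
      have := eS_mul_eS (n := n) k l
      rw [if_neg h', map_zero] at this
      exact eq_neg_of_add_eq_zero_left this

/-! ### The Fock module is smooth -/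

/-- A vector is smooth if all generators of sufficiently large mode annihilate it. -/
def IsSmooth (v : Fock n) : Prop :=
  ∃ N : ℤ, ∀ x : TGen n, N ≤ x.idx → gen n x • v = 0

theorem IsSmooth.add {v w : Fock n} (hv : IsSmooth v) (hw : IsSmooth w) : IsSmooth (v + w) := by
  obtain ⟨N, hN⟩ := hv
  obtain ⟨M, hM⟩ := hw
  refine ⟨max N M, fun x hx => ?_⟩
  rw [smul_add, hN x (le_trans (le_max_left _ _) hx), hM x (le_trans (le_max_right _ _) hx),
    add_zero]

theorem IsSmooth.algebraMap_smul {v : Fock n} (hv : IsSmooth v) (c : ℂ) :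
    IsSmooth (algebraMap ℂ (Lam n) c • v) := by
  obtain ⟨N, hN⟩ := hv
  refine ⟨N, fun x hx => ?_⟩
  rw [← mul_smul, ← Algebra.commutes, mul_smul, hN x hx, smul_zero]

theorem IsSmooth.gen_smul {v : Fock n} (hv : IsSmooth v) (y : TGen n) :
    IsSmooth (gen n y • v) := by
  obtain ⟨N, hN⟩ := hv
  refine ⟨max N (1 - y.idx), fun x hx => ?_⟩
  have hx' := max_le_iff.1 hx
  rcases gen_mul_gen_of_idx_add_ne_zero x y (by omega) with h | h <;>
    rw [← mul_smul, h] <;> simp only [neg_smul, mul_smul, hN x hx'.1, smul_zero, neg_zero]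

theorem IsSmooth.smul {v : Fock n} (hv : IsSmooth v) (a : Lam n) : IsSmooth (a • v) := by
  obtain ⟨a, rfl⟩ := RingQuot.mkAlgHom_surjective ℂ (TRel n) a
  induction a using FreeAlgebra.induction generalizing v with
  | grade0 c => rw [AlgHom.commutes]; exact hv.algebraMap_smul c
  | grade1 x => exact hv.gen_smul x
  | mul a b ha hb => rw [map_mul, mul_smul]; exact ha (hb hv)
  | add a b ha hb => rw [map_add, add_smul]; exact (ha hv).add (hb hv)

theorem isSmooth (v : Fock n) : IsSmooth v := by
  obtain ⟨a, rfl⟩ := Submodule.mkQ_surjective (fockIdeal n) v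
  have h1 : IsSmooth ((fockIdeal n).mkQ 1) := by
    refine ⟨1, fun x hx => ?_⟩
    rw [← map_smul, smul_eq_mul, mul_one, Submodule.mkQ_apply, Submodule.Quotient.mk_eq_zero]
    exact Submodule.subset_span ⟨x, hx, rfl⟩
  simpa only [← map_smul, smul_eq_mul, mul_one] using h1.smul a

/-- A series whose modes of sufficiently large index annihilate any given vector. -/
def IsSmoothSeries (x : ℤ → Lam n) : Prop :=
  ∀ v : Fock n, ∃ N : ℤ, ∀ k, N ≤ k → x k • v = 0

theorem isSmoothSeries_unS (u : BL n) : IsSmoothSeries (unS n u) := fun v =>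
  (isSmooth v).imp fun _ hN k hk => hN (.un u k) hk

theorem isSmoothSeries_stS (u : BL n) : IsSmoothSeries (stS n u) := fun v =>
  (isSmooth v).imp fun _ hN k hk => hN (.st u k) hk

theorem isSmoothSeries_eS : IsSmoothSeries (eS n) := fun v =>
  (isSmooth v).imp fun _ hN k hk => hN (.e k) hk

/-! ### Locally finite sums of operators -/

/-- A family of elements of Λ of which only finitely many act nontrivially on any vector. -/
def LocallyFiniteAction (f : ℤ → Lam n) : Prop :=
  ∀ v : Fock n, (Function.support fun k => f k • v).Finite

theorem IsSmoothSeries.locallyFiniteAction {x y : ℤ → Lam n} (hx : IsSmoothSeries x)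
    (hy : IsSmoothSeries y) (hxy : ∀ k l, Commute (x k) (y l)) (c : ℂ) (m : ℤ) :
    LocallyFiniteAction fun k => c • (x k * y (m - k)) := by
  intro v
  obtain ⟨N, hN⟩ := hx v
  obtain ⟨M, hM⟩ := hy v
  refine (Set.finite_Ioo (m - M) N).subset fun k hk => ?_
  by_contra hk'
  refine hk ?_
  have h0 : (x k * y (m - k)) • v = 0 := by
    rcases le_or_gt N k with h | h
    · rw [(hxy k (m - k)).eq, mul_smul, hN k h, smul_zero]
    · rw [mul_smul, hM (m - k) (by simp only [Set.mem_Ioo, not_and] at hk'; grind), smul_zero]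
  change (c • (x k * y (m - k))) • v = 0
  rw [Algebra.smul_def, mul_smul, h0, smul_zero]

theorem sumOp_add {f : ℤ → Lam n} (hf : LocallyFiniteAction f) (v w : Fock n) :
    sumOp n f (v + w) = sumOp n f v + sumOp n f w := by
  simp only [sumOp, smul_add]
  exact finsum_add_distrib (hf v) (hf w)

/-- A locally finite sum of operators, as an additive endomorphism. -/
def sumOpHom {f : ℤ → Lam n} (hf : LocallyFiniteAction f) : Fock n →+ Fock n :=
  AddMonoidHom.mk' (sumOp n f) (sumOp_add hf)

/-- If `f k * g = g * f k + δ_{k,k₀} d` then the commutator of `∑ f k` with `g` is `d`. -/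
theorem sumOp_smul_of_mul_eq {f : ℤ → Lam n} (hf : LocallyFiniteAction f) {g d : Lam n} {k₀ : ℤ}
    (h : ∀ k, f k * g = g * f k + if k = k₀ then d else 0) (v : Fock n) :
    sumOp n f (g • v) = g • sumOp n f v + d • v := by
  have hd : (fun k => (if k = k₀ then d else 0) • v) = fun k => if k = k₀ then d • v else 0 := by
    funext k; split_ifs <;> simp
  have hsupp : (Function.support fun k : ℤ => (if k = k₀ then d • v else 0)).Finite :=
    (Set.finite_singleton k₀).subset fun k hk => by
      by_contra hne
      exact hk (if_neg hne)
  have hgs : (Function.support fun k => g • f k • v).Finite :=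
    (hf v).subset fun k hk h0 => hk (by
      change f k • v = 0 at h0
      change g • f k • v = 0
      rw [h0, smul_zero])
  have key : ∀ k, f k • g • v = g • f k • v + if k = k₀ then d • v else 0 := fun k => by
    rw [← mul_smul, h k, add_smul, mul_smul, congrFun hd k]
  simp only [sumOp, key]
  rw [finsum_add_distrib hgs hsupp, finsum_eq_single _ k₀ fun k hk => if_neg hk, if_pos rfl,
    ← smul_finsum' g (hf v)]

theorem locallyFiniteAction_of_sumOp_smul {f g h : ℤ → Lam n} (hf : LocallyFiniteAction f)
    (hg : LocallyFiniteAction g)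
    (hfg : ∀ l v, sumOp n f (g l • v) = g l • sumOp n f v + h l • v) : LocallyFiniteAction h := by
  intro v
  refine ((hg v).union (hg (sumOp n f v))).subset fun l hl => ?_
  by_contra hn
  simp only [Set.mem_union, Function.mem_support, not_or, not_not] at hn
  have := hfg l v
  rw [hn.1, hn.2, zero_add, show sumOp n f 0 = 0 from (sumOpHom hf).map_zero] at this
  exact hl this.symm

theorem obrk_sumOp {f g h : ℤ → Lam n} (hf : LocallyFiniteAction f) (hg : LocallyFiniteAction g)
    (hfg : ∀ l v, sumOp n f (g l • v) = g l • sumOp n f v + h l • v) :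
    obrk n (sumOp n f) (sumOp n g) = sumOp n h := by
  funext v
  have hh := locallyFiniteAction_of_sumOp_smul hf hg hfg
  have hmap : sumOp n f (∑ᶠ l, g l • v) = ∑ᶠ l, sumOp n f (g l • v) :=
    (sumOpHom hf).map_finsum (hg v)
  change sumOp n f (∑ᶠ l, g l • v) - ∑ᶠ l, g l • sumOp n f v = ∑ᶠ l, h l • v
  simp only [hmap, hfg]
  rw [finsum_add_distrib (hg _) (hh v), add_sub_cancel_left]

theorem sumOp_comp_sub_left (f : ℤ → Lam n) (m : ℤ) :
    sumOp n (fun k => f (m - k)) = sumOp n f := by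
  funext v
  exact finsum_comp_equiv (Equiv.subLeft m) (f := fun k => f k • v)

/-! ### The Serre relation -/

theorem mul_mul_mul_eq_add {a t b e : Lam n} {c : ℂ} (hab : Commute a b) (hae : Commute a e)
    (hte : Commute t e) (htb : t * b = b * t + algebraMap ℂ _ c) :
    a * t * (b * e) = b * e * (a * t) + c • (a * e) := by
  calc a * t * (b * e) = a * (t * b) * e := by simp only [mul_assoc]
    _ = a * b * (t * e) + algebraMap ℂ _ c * (a * e) := by
      rw [htb, mul_add, add_mul, ← Algebra.commutes]; simp only [mul_assoc]
    _ = b * (a * e) * t + c • (a * e) := by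
      rw [hab.eq, hte.eq, Algebra.smul_def]; simp only [mul_assoc]
    _ = b * e * (a * t) + c • (a * e) := by rw [hae.eq]; simp only [mul_assoc]

/-- If `p`, `q`, `r`, `e` commute pairwise except for `e` with itself and
`[q(k), r(l)] = δ_{k,-l} c`, then bracketing `∑ r(k) e(m - k)` twice with sums
`∑ p(k) q(mᵢ - k)` gives zero. -/
theorem obrk_obrk_sumOp_eq_zero {p q r e : ℤ → Lam n} (hp : IsSmoothSeries p)
    (hq : IsSmoothSeries q) (hr : IsSmoothSeries r) (he : IsSmoothSeries e)
    (hpp : ∀ k l, Commute (p k) (p l)) (hpq : ∀ k l, Commute (p k) (q l))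
    (hpr : ∀ k l, Commute (p k) (r l)) (hpe : ∀ k l, Commute (p k) (e l))
    (hqe : ∀ k l, Commute (q k) (e l)) (hre : ∀ k l, Commute (r k) (e l)) (c : ℂ)
    (hqr : ∀ k l, q k * r l = r l * q k + algebraMap ℂ _ (if k + l = 0 then c else 0))
    (s t : ℂ) (m m1 m2 : ℤ) :
    obrk n (sumOp n fun k => s • (p k * q (m2 - k)))
      (obrk n (sumOp n fun k => s • (p k * q (m1 - k)))
        (sumOp n fun k => t • (r k * e (m - k)))) = fun _ => 0 := by
  have hf1 := hp.locallyFiniteAction hq hpq s m1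
  have hf2 := hp.locallyFiniteAction hq hpq s m2
  have hg := hr.locallyFiniteAction he hre t m
  have inner : ∀ l v, sumOp n (fun k => s • (p k * q (m1 - k))) ((t • (r l * e (m - l))) • v) =
      (t • (r l * e (m - l))) • sumOp n (fun k => s • (p k * q (m1 - k))) v +
        ((s * t * c) • (p (m1 + l) * e (m - l))) • v := fun l v => by
    refine sumOp_smul_of_mul_eq hf1 (k₀ := m1 + l) (fun k => ?_) v
    have hk := mul_mul_mul_eq_add (hpr k l) (hpe k (m - l)) (hqe (m1 - k) (m - l))
      (hqr (m1 - k) l)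
    rw [smul_mul_smul_comm, smul_mul_smul_comm, hk, smul_add, mul_comm t s, smul_smul]
    by_cases h : k = m1 + l
    · subst h; simp
    · rw [if_neg (by omega), if_neg h, mul_zero, zero_smul]
  have hh := locallyFiniteAction_of_sumOp_smul hf1 hg inner
  rw [obrk_sumOp hf1 hg inner, obrk_sumOp (h := fun _ => 0) hf2 hh fun l v => ?_]
  · funext v
    simp [sumOp]
  · refine sumOp_smul_of_mul_eq hf2 (k₀ := 0) (fun k => ?_) v
    rw [ite_self, add_zero]
    exact (((((hpp _ _).mul_right (hpe _ _)).mul_left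
      ((hpq _ _).symm.mul_right (hqe _ _))).smul_left s).smul_right _).eq

theorem nob_eq_mul {x y : ℤ → Lam n} (h : ∀ k l, Commute (x k) (y l)) (k l : ℤ) :
    nob n x y k l = x k * y l := by
  unfold nob
  split_ifs with h1 h2
  · rfl
  · exact (h k l).symm.eq
  · obtain rfl : k = 0 := by omega
    rw [← (h 0 l).eq, ← two_smul ℂ, smul_smul]
    norm_num

end FockModule

/-- Serre relation: [x_{n−1}^±(m_2), [x_{n−1}^±(m_1), x_n^±(m)]] = 0 on the Fock module V,
for all m, m_1, m_2 ∈ ℤ and both choices of sign (both brackets are ordinary commutators). -/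
theorem serre_relation_even (n : ℕ) (hn : 2 ≤ n) (m m1 m2 : ℤ) :
    (obrk n (xp n (n - 1) m2) (obrk n (xp n (n - 1) m1) (xp n n m)) = fun _ => 0) ∧
    (obrk n (xm n (n - 1) m2) (obrk n (xm n (n - 1) m1) (xm n n m)) = fun _ => 0) := by
  obtain ⟨i, hi⟩ : ∃ i : Fin n, (i : ℕ) = n - 1 - 1 := ⟨⟨n - 1 - 1, by omega⟩, rfl⟩
  obtain ⟨j, hj⟩ : ∃ j : Fin n, (j : ℕ) = n - 1 := ⟨⟨n - 1, by omega⟩, rfl⟩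
  have hij : i ≠ j := fun h => by have := congrArg Fin.val h; omega
  have hUi : epU n (n - 1) = unS n (some i) := by
    rw [epU, dif_pos (by omega)]; congr 2; exact Fin.ext hi.symm
  have hUj : epU n n = unS n (some j) := by
    rw [epU, dif_pos (by omega)]; congr 2; exact Fin.ext hj.symm
  have hSi : epSt n (n - 1) = stS n (some i) := by
    rw [epSt, dif_pos (by omega)]; congr 2; exact Fin.ext hi.symm
  have hSj : epSt n n = stS n (some j) := by
    rw [epSt, dif_pos (by omega)]; congr 2; exact Fin.ext hj.symm
  have hn0 : n ≠ 0 := by omega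
  have hn1 : n - 1 ≠ 0 := by omega
  have hn2 : n - 1 ≠ n := by omega
  have hn3 : n - 1 + 1 = n := by omega
  have hUS := unS_commute_stS_of_ne hij
  have hUS' := unS_commute_stS_of_ne hij.symm
  have hp (l : ℤ) : xp n (n - 1) l =
      sumOp n fun k => (1 : ℂ) • (unS n (some i) k * stS n (some j) (l - k)) := by
    simp only [xp, if_neg hn1, if_neg hn2, hn3, hUi, hSj, nob_eq_mul hUS, one_smul]
  have hm (l : ℤ) : xm n (n - 1) l =
      sumOp n fun k => (-1 : ℂ) • (stS n (some i) k * unS n (some j) (l - k)) := by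
    rw [← sumOp_comp_sub_left _ l]
    simp only [xm, if_neg hn1, if_neg hn2, hn3, hUj, hSi, nob_eq_mul hUS', sub_sub_cancel,
      (hUS' _ _).eq]
    exact congrArg (sumOp n) (funext fun k => (neg_one_smul ℂ _).symm)
  have hpn : xp n n m = sumOp n fun k =>
      ((Real.sqrt 2 : ℝ) : ℂ) • (unS n (some j) k * eS n (m - k)) := by
    simp only [xp, if_neg hn0, if_true, hUj]
  have hmn : xm n n m = sumOp n fun k =>
      (-((Real.sqrt 2 : ℝ) : ℂ)) • (stS n (some j) k * eS n (m - k)) := by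
    simp only [xm, if_neg hn0, if_true, hSj]
  rw [hp, hp, hm, hm, hpn, hmn]
  constructor
  · refine obrk_obrk_sumOp_eq_zero (isSmoothSeries_unS _) (isSmoothSeries_stS _)
      (isSmoothSeries_unS _) isSmoothSeries_eS (unS_commute_unS _ _) hUS (unS_commute_unS _ _)
      (unS_commute_eS _) (stS_commute_eS _) (unS_commute_eS _) (-1) (fun k l => ?_) _ _ m m1 m2
    rw [unS_mul_stS, add_comm l k]
    split_ifs <;> simp [pairB]
  · refine obrk_obrk_sumOp_eq_zero (isSmoothSeries_stS _) (isSmoothSeries_unS _)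
      (isSmoothSeries_stS _) isSmoothSeries_eS (stS_commute_stS _ _)
      (fun k l => (hUS' l k).symm) (stS_commute_stS _ _)
      (stS_commute_eS _) (unS_commute_eS _) (stS_commute_eS _) 1 (fun k l => ?_) _ _ m m1 m2
    rw [unS_mul_stS]
    simp [pairB]
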